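/- Let G ∈ W₊^{m×p} (Wiener class) with T_G T_G* strictly positive. Then the function Y(z) = I_p − z E_p*(I − z S_p*)⁻¹ T_G*(T_G T_G*)⁻¹ H_G E_p belongs to the Wiener class W₊^{p×p}, its continuous extension to the closed unit disc satisfies det Y(z) ≠ 0 for every |z| ≤ 1, the function z ↦ Y(z)⁻¹ belongs to W₊^{p×p} (so Y is invertible outer), and Y(z)⁻¹ = I_p + z E_p* T_G*(T_G T_G*)⁻¹ H_G (I − z S_p)⁻¹ E_p for z ∈ 𝔻. -/

import Mathlib

/-!
Setting: `l2 n` models ℓ²₊(ℂⁿ); `lp.single 2 0` is the canonical embedding `E_n`, and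
evaluating a sequence at coordinate `k` realizes `E_n* (S_n*)^k`.  Block Toeplitz and
Hankel operators, as well as the (bounded) inverse of `T_G T_G*`, are specified through
their actions on the standard basis vectors of the coordinate spaces.
-/

noncomputable section
open scoped Matrix

/-- ℂⁿ with the Euclidean norm. -/
abbrev ES (n : ℕ) : Type := EuclideanSpace ℂ (Fin n)

/-- ℓ²₊(ℂⁿ). -/
abbrev l2 (n : ℕ) : Type := lp (fun _ : ℕ => ES n) 2

/-- The `b`-th standard basis vector of ℂⁿ. -/
abbrev eVec (n : ℕ) (b : Fin n) : ES n := EuclideanSpace.single b 1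

/-- The matrix function `z ↦ ∑' ν, z ^ ν • F ν` determined by a coefficient sequence. -/
def seriesM {r s : ℕ} (F : ℕ → Matrix (Fin r) (Fin s) ℂ) (z : ℂ) :
    Matrix (Fin r) (Fin s) ℂ :=
  Matrix.of fun a b => ∑' ν : ℕ, z ^ ν * F ν a b

open scoped BoundedContinuousFunction

theorem summable_conv {ι : Type} {α : ι → ℝ} {b : ℤ → ℝ} (d : ι → ℤ) (hα0 : ∀ i, 0 ≤ α i)
    (hb0 : ∀ k, 0 ≤ b k) (hα : Summable α) (hb : Summable b) :
    (∀ k, Summable fun i => α i * b (k + d i)) ∧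
      HasSum (fun k => ∑' i, α i * b (k + d i)) ((∑' i, α i) * ∑' k, b k) := by
  have hrow : ∀ i, HasSum (fun k => α i * b (k + d i)) (α i * ∑' k, b k) := fun i =>
    (((Equiv.addRight (d i)).hasSum_iff (f := b)).2 hb.hasSum).mul_left (α i)
  have hs : Summable fun q : ι × ℤ => α q.1 * b (q.2 + d q.1) := by
    rw [summable_prod_of_nonneg fun q => mul_nonneg (hα0 _) (hb0 _)]
    refine ⟨fun i => (hrow i).summable, ?_⟩
    simp_rw [fun i => (hrow i).tsum_eq]
    exact hα.mul_right _
  have hs' := (Equiv.prodComm ℤ ι).summable_iff.2 hs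
  refine ⟨fun k => hs'.prod_factor k, ?_⟩
  have h1 := hs'.hasSum.prod_fiberwise fun k => (hs'.prod_factor k).hasSum
  have h2 := hs.hasSum.prod_fiberwise hrow
  have h3 : ∑' c, ((fun q : ι × ℤ => α q.1 * b (q.2 + d q.1)) ∘ Equiv.prodComm ℤ ι) c
      = (∑' i, α i) * ∑' k, b k := by
    rw [← tsum_mul_right, h2.tsum_eq]
    exact (Equiv.prodComm ℤ ι).tsum_eq (fun q : ι × ℤ => α q.1 * b (q.2 + d q.1))
  rw [h3] at h1
  exact h1

/-- A function dominated by a summable function plus an averaging of itself of total mass at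
most one half is summable. -/
theorem summable_of_le_add_conv {ι : Type} {γ : ι → ℝ} {b c : ℤ → ℝ} (d : ι → ℤ) {B : ℝ}
    (hγ0 : ∀ i, 0 ≤ γ i) (hb0 : ∀ k, 0 ≤ b k) (hc0 : ∀ k, 0 ≤ c k) (hbB : ∀ k, b k ≤ B)
    (hγ : Summable γ) (hc : Summable c) (hγ1 : ∑' i, γ i ≤ 1 / 2)
    (h : ∀ k, b k ≤ c k + ∑' i, γ i * b (k + d i)) : Summable b := by
  have hB : 0 ≤ B := (hb0 0).trans (hbB 0)
  have key : ∀ n : ℕ, ∃ e : ℤ → ℝ, (∀ k, 0 ≤ e k) ∧ Summable e ∧ ∑' k, e k ≤ 2 * ∑' k, c k ∧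
      ∀ k, b k ≤ e k + B * (1 / 2) ^ n := by
    intro n
    induction n with
    | zero =>
      refine ⟨fun _ => 0, fun _ => le_rfl, summable_zero, ?_, fun k => by simpa using hbB k⟩
      simpa using tsum_nonneg hc0
    | succ n ih =>
      obtain ⟨e, he0, he, hes, heb⟩ := ih
      obtain ⟨hk, hconv⟩ := summable_conv d hγ0 he0 hγ he
      refine ⟨fun k => c k + ∑' i, γ i * e (k + d i), fun k => add_nonneg (hc0 k)
        (tsum_nonneg fun i => mul_nonneg (hγ0 i) (he0 _)), hc.add hconv.summable, ?_, ?_⟩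
      · rw [hc.tsum_add hconv.summable, hconv.tsum_eq]
        have : (∑' i, γ i) * ∑' k, e k ≤ 1 / 2 * (2 * ∑' k, c k) :=
          mul_le_mul hγ1 hes (tsum_nonneg he0) (by norm_num)
        linarith
      · intro k
        refine (h k).trans ?_
        have hs2 : Summable fun i => γ i * (B * (1 / 2) ^ n) := hγ.mul_right _
        have h1 : ∑' i, γ i * b (k + d i) ≤ ∑' i,
            (γ i * e (k + d i) + γ i * (B * (1 / 2) ^ n)) := by
          refine Summable.tsum_le_tsum (fun i => ?_) ?_ ((hk k).add hs2)
          · rw [← mul_add]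
            exact mul_le_mul_of_nonneg_left (heb _) (hγ0 i)
          · exact (hγ.mul_right B).of_nonneg_of_le (fun i => mul_nonneg (hγ0 i) (hb0 _))
              fun i => mul_le_mul_of_nonneg_left (hbB _) (hγ0 i)
        rw [(hk k).tsum_add hs2, tsum_mul_right] at h1
        have h2 : (∑' i, γ i) * (B * (1 / 2) ^ n) ≤ 1 / 2 * (B * (1 / 2) ^ n) :=
          mul_le_mul_of_nonneg_right hγ1 (by positivity)
        rw [pow_succ]
        linarith
  refine summable_of_sum_le (c := 2 * ∑' k, c k) hb0 fun s => ?_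
  have hlim : Filter.Tendsto (fun n : ℕ => 2 * ∑' k, c k + s.card * (B * (1 / 2 : ℝ) ^ n))
      Filter.atTop (nhds (2 * ∑' k, c k + s.card * (B * 0))) :=
    (((tendsto_pow_atTop_nhds_zero_of_lt_one (by norm_num) (by norm_num)).const_mul B).const_mul
      _).const_add _
  rw [mul_zero, mul_zero, add_zero] at hlim
  refine ge_of_tendsto' hlim fun n => ?_
  obtain ⟨e, he0, he, hes, heb⟩ := key n
  calc ∑ k ∈ s, b k ≤ ∑ k ∈ s, (e k + B * (1 / 2) ^ n) := Finset.sum_le_sum fun k _ => heb k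
    _ = ∑ k ∈ s, e k + s.card * (B * (1 / 2) ^ n) := by
      rw [Finset.sum_add_distrib, Finset.sum_const, nsmul_eq_mul]
    _ ≤ _ := by
      gcongr
      exact (he.sum_le_tsum s fun k _ => he0 k).trans hes

/-- Pointwise multiplication of a sequence by a bounded real weight. -/
def wmul {n : ℕ} (w : ℤ →ᵇ ℝ) : l2 n →L[ℂ] l2 n :=
  lp.mapCLM 2 (fun i : ℕ => ((w i : ℝ) : ℂ) • ContinuousLinearMap.id ℂ (ES n)) (norm_nonneg w)
    fun i => by
      refine (norm_smul_le _ _).trans ?_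
      rw [Complex.norm_real]
      exact (mul_le_of_le_one_right (norm_nonneg _) ContinuousLinearMap.norm_id_le).trans
        (w.norm_coe_le_norm _)

@[simp]
theorem wmul_apply {n : ℕ} (w : ℤ →ᵇ ℝ) (u : l2 n) (i : ℕ) :
    (wmul w u) i = ((w i : ℝ) : ℂ) • u i := rfl

theorem wmul_sub {n : ℕ} (w w' : ℤ →ᵇ ℝ) (u : l2 n) :
    wmul (w - w') u = wmul w u - wmul w' u := by
  ext i : 2
  rw [lp.coeFn_sub, Pi.sub_apply]
  simp [sub_smul]

theorem norm_wmul_le {n : ℕ} (w : ℤ →ᵇ ℝ) {c : ℝ} (hc : ∀ i, |w i| ≤ c) (u : l2 n) :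
    ‖wmul w u‖ ≤ c * ‖u‖ := by
  have hc0 : 0 ≤ c := (abs_nonneg _).trans (hc 0)
  calc ‖wmul w u‖ ≤ ‖(c : ℂ) • u‖ := by
        refine lp.norm_mono two_ne_zero fun i => ?_
        rw [wmul_apply, lp.coeFn_smul, Pi.smul_apply, norm_smul, norm_smul, Complex.norm_real,
          Complex.norm_real, Real.norm_eq_abs, Real.norm_eq_abs, abs_of_nonneg hc0]
        exact mul_le_mul_of_nonneg_right (hc _) (norm_nonneg _)
    _ = c * ‖u‖ := by rw [norm_smul, Complex.norm_real, Real.norm_eq_abs, abs_of_nonneg hc0]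

theorem norm_wmul_le_wmul {n : ℕ} (w w' : ℤ →ᵇ ℝ) {c : ℝ} (hc0 : 0 ≤ c)
    (hc : ∀ i, |w i| ≤ c * |w' i|) (u : l2 n) : ‖wmul w u‖ ≤ c * ‖wmul w' u‖ := by
  calc ‖wmul w u‖ ≤ ‖(c : ℂ) • wmul w' u‖ := by
        refine lp.norm_mono two_ne_zero fun i => ?_
        rw [wmul_apply, lp.coeFn_smul, Pi.smul_apply, norm_smul, norm_smul, wmul_apply, norm_smul,
          Complex.norm_real, Complex.norm_real, Complex.norm_real, Real.norm_eq_abs,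
          Real.norm_eq_abs, Real.norm_eq_abs, abs_of_nonneg hc0, ← mul_assoc]
        exact mul_le_mul_of_nonneg_right (hc _) (norm_nonneg _)
    _ = c * ‖wmul w' u‖ := by
      rw [norm_smul, Complex.norm_real, Real.norm_eq_abs, abs_of_nonneg hc0]

theorem inner_wmul_left {n : ℕ} (w : ℤ →ᵇ ℝ) (u v : l2 n) :
    inner ℂ (wmul w u) v = inner ℂ u (wmul w v) := by
  rw [lp.inner_eq_tsum, lp.inner_eq_tsum]
  simp only [wmul_apply, inner_smul_left, inner_smul_right, Complex.conj_ofReal]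

/-- The shift `x ↦ w (x + d)` of a weight. -/
def shiftWeight (d : ℤ) (w : ℤ →ᵇ ℝ) : ℤ →ᵇ ℝ :=
  w.compContinuous ⟨(· + d), continuous_of_discreteTopology⟩

@[simp]
theorem shiftWeight_apply (d : ℤ) (w : ℤ →ᵇ ℝ) (x : ℤ) : shiftWeight d w x = w (x + d) := rfl

theorem shiftWeight_shiftWeight (d e : ℤ) (w : ℤ →ᵇ ℝ) :
    shiftWeight d (shiftWeight e w) = shiftWeight (e + d) w := by
  ext x
  simp [add_assoc, add_comm d e]

theorem shiftWeight_zero (w : ℤ →ᵇ ℝ) : shiftWeight 0 w = w := by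
  ext x
  simp

/-- `X` shifts sequences by `d` places: its only nonzero block diagonal is the `d`-th one. -/
def HasDegree {n n' : ℕ} (d : ℤ) (X : l2 n →L[ℂ] l2 n') : Prop :=
  ∀ w u, wmul w (X u) = X (wmul (shiftWeight d w) u)

theorem HasDegree.comp {n n' n'' : ℕ} {d e : ℤ} {X : l2 n' →L[ℂ] l2 n''} {Z : l2 n →L[ℂ] l2 n'}
    (hX : HasDegree d X) (hZ : HasDegree e Z) : HasDegree (d + e) (X ∘L Z) := by
  intro w u
  rw [ContinuousLinearMap.comp_apply, hX, hZ, shiftWeight_shiftWeight,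
    ContinuousLinearMap.comp_apply]

theorem HasDegree.adjoint {n n' : ℕ} {d : ℤ} {X : l2 n →L[ℂ] l2 n'} (hX : HasDegree d X) :
    HasDegree (-d) X.adjoint := by
  intro w u
  refine ext_inner_left ℂ fun v => ?_
  rw [← inner_wmul_left, ContinuousLinearMap.adjoint_inner_right,
    ContinuousLinearMap.adjoint_inner_right, ← inner_wmul_left, hX, shiftWeight_shiftWeight,
    neg_add_cancel, shiftWeight_zero]

/-- `X` is an absolutely convergent sum of its block diagonals. -/
def IsWienerOp {n n' : ℕ} (X : l2 n →L[ℂ] l2 n') : Prop :=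
  ∃ (ι : Type) (F : ι → l2 n →L[ℂ] l2 n') (d : ι → ℤ),
    Summable (fun i => ‖F i‖) ∧ HasSum F X ∧ ∀ i, HasDegree (d i) (F i)

theorem IsWienerOp.adjoint {n n' : ℕ} {X : l2 n →L[ℂ] l2 n'} (hX : IsWienerOp X) :
    IsWienerOp X.adjoint := by
  obtain ⟨ι, F, d, hs, hF, hd⟩ := hX
  refine ⟨ι, fun i => (F i).adjoint, fun i => -d i, ?_, ?_, fun i => (hd i).adjoint⟩
  · simpa using hs
  · exact hF.map ContinuousLinearMap.adjoint ContinuousLinearMap.adjoint.continuous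

theorem IsWienerOp.comp {n n' n'' : ℕ} {X : l2 n' →L[ℂ] l2 n''} {Z : l2 n →L[ℂ] l2 n'}
    (hX : IsWienerOp X) (hZ : IsWienerOp Z) : IsWienerOp (X ∘L Z) := by
  obtain ⟨ι, F, d, hs, hF, hd⟩ := hX
  obtain ⟨κ, H, e, hs', hH, he⟩ := hZ
  have hsum : Summable fun q : ι × κ => ‖F q.1 ∘L H q.2‖ :=
    (hs.mul_of_nonneg hs' (fun _ => norm_nonneg _) fun _ => norm_nonneg _).of_nonneg_of_le
      (fun _ => norm_nonneg _) fun q => ContinuousLinearMap.opNorm_comp_le _ _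
  refine ⟨ι × κ, fun q => F q.1 ∘L H q.2, fun q => d q.1 + e q.2, hsum, ?_,
    fun q => (hd q.1).comp (he q.2)⟩
  have h1 : ∀ i, HasSum (fun j => F i ∘L H j) (F i ∘L Z) := fun i =>
    (ContinuousLinearMap.compL ℂ (l2 n) (l2 n') (l2 n'') (F i)).hasSum hH
  have h2 : HasSum (fun i => F i ∘L Z) (X ∘L Z) :=
    ((ContinuousLinearMap.compL ℂ (l2 n) (l2 n') (l2 n'')).flip Z).hasSum hF
  have h3 := hsum.of_norm.hasSum.prod_fiberwise h1
  rw [h2.unique h3]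
  exact hsum.of_norm.hasSum

theorem IsWienerOp.summable_wmul {n n' : ℕ} {X : l2 n →L[ℂ] l2 n'} (hX : IsWienerOp X)
    (w : ℤ →ᵇ ℝ) (u : l2 n) (hu : Summable fun k : ℤ => ‖wmul (shiftWeight k w) u‖) :
    Summable fun k : ℤ => ‖wmul (shiftWeight k w) (X u)‖ := by
  obtain ⟨ι, F, d, hs, hF, hd⟩ := hX
  obtain ⟨h1, h2⟩ := summable_conv d (fun i => norm_nonneg (F i)) (fun k => norm_nonneg _) hs hu
  refine h2.summable.of_nonneg_of_le (fun k => norm_nonneg _) fun k => ?_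
  have h3 : HasSum (fun i => F i (wmul (shiftWeight (k + d i) w) u))
      (wmul (shiftWeight k w) (X u)) := by
    have := (wmul (shiftWeight k w)).hasSum ((ContinuousLinearMap.apply ℂ (l2 n') u).hasSum hF)
    refine this.congr_fun fun i => ?_
    simp [hd i _ _, shiftWeight_shiftWeight]
  rw [← h3.tsum_eq]
  exact tsum_of_norm_bounded (h1 k).hasSum fun i => (F i).le_opNorm _

theorem hasSum_wmul {n : ℕ} (w : ℤ →ᵇ ℝ) (f : l2 n) :
    HasSum (fun x : ℕ => lp.single 2 x (((w x : ℝ) : ℂ) • f x)) (wmul w f) :=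
  lp.hasSum_single ENNReal.ofNat_ne_top (wmul w f)

theorem summable_norm_wmul {n : ℕ} (w : ℤ →ᵇ ℝ) (hw : Summable fun x => |w x|) (f : l2 n)
    (hf : Summable fun x => ‖f x‖) : Summable fun k : ℤ => ‖wmul (shiftWeight k w) f‖ := by
  obtain ⟨h1, h2⟩ := summable_conv (fun x : ℕ => (x : ℤ)) (fun x => norm_nonneg (f x))
    (fun k => abs_nonneg (w k)) hf hw
  refine h2.summable.of_nonneg_of_le (fun k => norm_nonneg _) fun k => ?_
  rw [← (hasSum_wmul (shiftWeight k w) f).tsum_eq]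
  refine tsum_of_norm_bounded (h1 k).hasSum fun x => ?_
  rw [lp.norm_single two_pos, norm_smul, Complex.norm_real, Real.norm_eq_abs, mul_comm,
    shiftWeight_apply, add_comm (x : ℤ) k]

theorem summable_of_summable_norm_wmul {n : ℕ} (w : ℤ →ᵇ ℝ) (hw : w 0 = 1) (f : l2 n)
    (hf : Summable fun k : ℤ => ‖wmul (shiftWeight k w) f‖) : Summable fun x => ‖f x‖ := by
  have hinj : Function.Injective fun x : ℕ => -(x : ℤ) := fun x y h => by simpa using h
  refine (hf.comp_injective hinj).of_nonneg_of_le (fun x => norm_nonneg _) fun x => ?_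
  have := lp.norm_apply_le_norm two_ne_zero (wmul (shiftWeight (-(x : ℤ)) w) f) x
  simpa [hw] using this

/-- The weight `x ↦ r ^ |x|`. -/
def expWeight (r : ℝ) (h0 : 0 < r) (h1 : r < 1) : ℤ →ᵇ ℝ :=
  BoundedContinuousFunction.ofNormedAddCommGroupDiscrete (fun x : ℤ => r ^ x.natAbs) 1 fun x => by
    rw [Real.norm_eq_abs, abs_of_nonneg (by positivity)]
    exact pow_le_one₀ h0.le h1.le

@[simp]
theorem expWeight_apply (r : ℝ) (h0 : 0 < r) (h1 : r < 1) (x : ℤ) :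
    expWeight r h0 h1 x = r ^ x.natAbs := rfl

theorem summable_expWeight (r : ℝ) (h0 : 0 < r) (h1 : r < 1) :
    Summable fun x => |expWeight r h0 h1 x| := by
  simp_rw [expWeight_apply, fun x : ℤ => abs_of_nonneg (pow_nonneg h0.le x.natAbs)]
  have := summable_geometric_of_lt_one h0.le h1
  exact Summable.of_nat_of_neg (by simpa using this) (by simpa using this)

theorem abs_expWeight_sub_le (r : ℝ) (h0 : 0 < r) (h1 : r < 1) (x d : ℤ) :
    |expWeight r h0 h1 x - expWeight r h0 h1 (x + d)| ≤
      ((r⁻¹) ^ d.natAbs - 1) * expWeight r h0 h1 x := by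
  simp only [expWeight_apply]
  have e : (r⁻¹) ^ d.natAbs * r ^ d.natAbs = 1 := by
    rw [← mul_pow, inv_mul_cancel₀ h0.ne', one_pow]
  have hq : 1 ≤ (r⁻¹) ^ d.natAbs := one_le_pow₀ ((one_le_inv₀ h0).2 h1.le)
  have ha : 0 < r ^ x.natAbs := by positivity
  have hd : 0 < r ^ d.natAbs := by positivity
  have i1 : r ^ (x + d).natAbs * r ^ d.natAbs ≤ r ^ x.natAbs := by
    rw [← pow_add]
    exact pow_le_pow_of_le_one h0.le h1.le (by omega)
  have i2 : r ^ x.natAbs * r ^ d.natAbs ≤ r ^ (x + d).natAbs := by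
    rw [← pow_add]
    exact pow_le_pow_of_le_one h0.le h1.le (by omega)
  have j1 : r ^ (x + d).natAbs ≤ r⁻¹ ^ d.natAbs * r ^ x.natAbs := by
    have := mul_le_mul_of_nonneg_left i1 (zero_le_one.trans hq)
    rwa [mul_comm (r ^ (x + d).natAbs), ← mul_assoc, e, one_mul] at this
  have j2 : 2 ≤ r⁻¹ ^ d.natAbs + r ^ d.natAbs := by
    nlinarith [sq_nonneg (r⁻¹ ^ d.natAbs - r ^ d.natAbs)]
  rw [abs_le]
  constructor
  · nlinarith
  · nlinarith

theorem IsWienerOp.summable_apply {n n' : ℕ} {X : l2 n →L[ℂ] l2 n'} (hX : IsWienerOp X)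
    (u : l2 n) (hu : Summable fun x => ‖u x‖) : Summable fun x => ‖(X u) x‖ := by
  let w := expWeight (1 / 2) (by norm_num) (by norm_num)
  exact summable_of_summable_norm_wmul w (by simp [w]) _
    (hX.summable_wmul w u (summable_norm_wmul w (summable_expWeight _ _ _) u hu))

/-- Spectral invariance: solving an equation with a Wiener class operator that is bounded below
on `ℓ²` does not lead out of `ℓ¹`. -/
theorem IsWienerOp.summable_of_apply {n n' : ℕ} {A : l2 n →L[ℂ] l2 n'} (hA : IsWienerOp A) {C : ℝ}
    (hC : ∀ u, ‖u‖ ≤ C * ‖A u‖) (u : l2 n) (hu : Summable fun x => ‖(A u) x‖) :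
    Summable fun x => ‖u x‖ := by
  classical
  wlog hC0 : 0 < C generalizing C
  · exact this (C := 1) (fun v => (hC v).trans (by nlinarith [norm_nonneg (A v)])) one_pos
  obtain ⟨ι, F, d, hs, hF, hd⟩ := hA
  obtain ⟨s, hs1⟩ : ∃ s : Finset ι, ∑' i, ‖F i‖ - ∑ i ∈ s, ‖F i‖ < 1 / (8 * C) := by
    have h : ∑' i, ‖F i‖ - 1 / (8 * C) < ∑' i, ‖F i‖ := by
      have : 0 < 1 / (8 * C) := by positivity
      linarith
    obtain ⟨s, hs'⟩ := (hs.hasSum.eventually (lt_mem_nhds h)).exists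
    exact ⟨s, by linarith⟩
  obtain ⟨r, ⟨hr0, hr⟩, hr1⟩ : ∃ r : ℝ, (0 < r ∧
      ∑ i ∈ s, ‖F i‖ * ((r⁻¹) ^ (d i).natAbs - 1) < 1 / (8 * C)) ∧ r < 1 := by
    have hc : ContinuousAt (fun r : ℝ => ∑ i ∈ s, ‖F i‖ * ((r⁻¹) ^ (d i).natAbs - 1)) 1 := by
      refine tendsto_finsetSum _ fun i _ => ?_
      exact (((continuousAt_inv₀ one_ne_zero).pow _).sub continuousAt_const).const_mul _
    have h1 : ∀ᶠ r : ℝ in nhds 1, ∑ i ∈ s, ‖F i‖ * ((r⁻¹) ^ (d i).natAbs - 1) < 1 / (8 * C) :=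
      hc.eventually_lt_const (by simpa using hC0)
    have h2 := ((lt_mem_nhds (zero_lt_one (α := ℝ))).and h1).filter_mono
      (nhdsWithin_le_nhds (s := Set.Iio 1))
    exact (h2.and self_mem_nhdsWithin).exists
  let w := expWeight r hr0 hr1
  have hw := summable_expWeight r hr0 hr1
  let β : ι → ℝ := fun i => if i ∈ s then ‖F i‖ * ((r⁻¹) ^ (d i).natAbs - 1) else ‖F i‖
  let γ : ι → ℝ := fun i => if i ∈ s then 0 else ‖F i‖
  have hγsum : HasSum γ (∑' i, ‖F i‖ - ∑ i ∈ s, ‖F i‖) := by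
    have h1 : HasSum (fun i => if i ∈ s then ‖F i‖ else 0) (∑ i ∈ s, ‖F i‖) := by
      have : HasSum (fun i => if i ∈ s then ‖F i‖ else 0) (∑ i ∈ s, if i ∈ s then ‖F i‖ else 0) :=
        hasSum_sum_of_ne_finset_zero fun i hi => if_neg hi
      rwa [Finset.sum_congr rfl fun i hi => if_pos hi] at this
    refine (hs.hasSum.sub h1).congr_fun fun i => ?_
    by_cases hi : i ∈ s <;> simp [γ, hi]
  have hβsum : HasSum β (∑ i ∈ s, ‖F i‖ * ((r⁻¹) ^ (d i).natAbs - 1) +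
      (∑' i, ‖F i‖ - ∑ i ∈ s, ‖F i‖)) := by
    have h1 : HasSum (fun i => if i ∈ s then ‖F i‖ * ((r⁻¹) ^ (d i).natAbs - 1) else 0)
        (∑ i ∈ s, ‖F i‖ * ((r⁻¹) ^ (d i).natAbs - 1)) := by
      have : HasSum (fun i => if i ∈ s then ‖F i‖ * ((r⁻¹) ^ (d i).natAbs - 1) else 0)
          (∑ i ∈ s, if i ∈ s then ‖F i‖ * ((r⁻¹) ^ (d i).natAbs - 1) else 0) :=
        hasSum_sum_of_ne_finset_zero fun i hi => if_neg hi
      rwa [Finset.sum_congr rfl fun i hi => if_pos hi] at this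
    refine (h1.add hγsum).congr_fun fun i => ?_
    by_cases hi : i ∈ s <;> simp [β, γ, hi]
  have hγ0 : ∀ i, 0 ≤ γ i := fun i => by
    by_cases hi : i ∈ s <;> simp [γ, hi]
  refine summable_of_summable_norm_wmul w (by simp [w]) u ?_
  have hbB : ∀ k : ℤ, ‖wmul (shiftWeight k w) u‖ ≤ ‖u‖ := fun k => by
    have := norm_wmul_le (shiftWeight k w) (c := 1) (fun i => by
      rw [shiftWeight_apply, expWeight_apply, abs_of_nonneg (by positivity)]
      exact pow_le_one₀ hr0.le hr1.le) u
    rwa [one_mul] at this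
  have hterm : ∀ (k : ℤ) (i : ι),
      ‖F i‖ * ‖wmul (shiftWeight k w - shiftWeight (k + d i) w) u‖ ≤
        β i * ‖wmul (shiftWeight k w) u‖ + γ i * ‖wmul (shiftWeight (k + d i) w) u‖ := by
    intro k i
    by_cases hi : i ∈ s
    · simp only [β, γ, if_pos hi, zero_mul, add_zero, mul_assoc]
      refine mul_le_mul_of_nonneg_left ?_ (norm_nonneg _)
      refine norm_wmul_le_wmul _ _ (sub_nonneg.2 (one_le_pow₀ ((one_le_inv₀ hr0).2 hr1.le))) ?_ _
      intro x
      rw [BoundedContinuousFunction.coe_sub, Pi.sub_apply, shiftWeight_apply, shiftWeight_apply,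
        ← add_assoc]
      refine (abs_expWeight_sub_le r hr0 hr1 _ _).trans ?_
      exact mul_le_mul_of_nonneg_left (le_abs_self _)
        (sub_nonneg.2 (one_le_pow₀ ((one_le_inv₀ hr0).2 hr1.le)))
    · simp only [β, γ, if_neg hi, ← mul_add, wmul_sub]
      exact mul_le_mul_of_nonneg_left (norm_sub_le _ _) (norm_nonneg _)
  have hmain : ∀ k : ℤ, ‖wmul (shiftWeight k w) u‖ ≤ 2 * C * ‖wmul (shiftWeight k w) (A u)‖ +
      ∑' i, 2 * C * γ i * ‖wmul (shiftWeight (k + d i) w) u‖ := by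
    intro k
    have hγk : Summable fun i => γ i * ‖wmul (shiftWeight (k + d i) w) u‖ :=
      (hγsum.summable.mul_right ‖u‖).of_nonneg_of_le
        (fun i => mul_nonneg (hγ0 i) (norm_nonneg _))
        fun i => mul_le_mul_of_nonneg_left (hbB _) (hγ0 i)
    have hcomm : HasSum (fun i => F i (wmul (shiftWeight k w - shiftWeight (k + d i) w) u))
        (A (wmul (shiftWeight k w) u) - wmul (shiftWeight k w) (A u)) := by
      have h1 := (ContinuousLinearMap.apply ℂ (l2 n') (wmul (shiftWeight k w) u)).hasSum hF
      have h2 := (wmul (shiftWeight k w)).hasSum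
        ((ContinuousLinearMap.apply ℂ (l2 n') u).hasSum hF)
      refine (h1.sub h2).congr_fun fun i => ?_
      simp [hd i _ _, shiftWeight_shiftWeight, wmul_sub]
    have hbound : ‖A (wmul (shiftWeight k w) u) - wmul (shiftWeight k w) (A u)‖ ≤
        (∑' i, β i) * ‖wmul (shiftWeight k w) u‖ +
          ∑' i, γ i * ‖wmul (shiftWeight (k + d i) w) u‖ := by
      rw [← hcomm.tsum_eq]
      refine tsum_of_norm_bounded (((hβsum.summable.hasSum.mul_right _).add hγk.hasSum)) fun i => ?_
      exact ((F i).le_opNorm _).trans (hterm k i)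
    have hβC : C * ∑' i, β i ≤ 1 / 4 := by
      rw [hβsum.tsum_eq]
      have : C * (1 / (8 * C) + 1 / (8 * C)) = 1 / 4 := by field_simp; norm_num
      rw [← this]
      gcongr
    have htri : ‖A (wmul (shiftWeight k w) u)‖ ≤ ‖wmul (shiftWeight k w) (A u)‖ +
        ‖A (wmul (shiftWeight k w) u) - wmul (shiftWeight k w) (A u)‖ := by
      have := norm_add_le (wmul (shiftWeight k w) (A u))
        (A (wmul (shiftWeight k w) u) - wmul (shiftWeight k w) (A u))
      rwa [add_sub_cancel] at this
    have h3 := (hC (wmul (shiftWeight k w) u)).trans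
      (mul_le_mul_of_nonneg_left (htri.trans (add_le_add_right hbound _)) hC0.le)
    have h4 := mul_le_mul_of_nonneg_right hβC (norm_nonneg (wmul (shiftWeight k w) u))
    have h5 := norm_nonneg (wmul (shiftWeight k w) u)
    simp_rw [mul_assoc (2 * C)]
    rw [tsum_mul_left]
    nlinarith
  refine summable_of_le_add_conv d (fun i => mul_nonneg (by positivity) (hγ0 i))
    (fun k => norm_nonneg _) (fun k => by positivity) hbB (hγsum.summable.mul_left _)
    ((summable_norm_wmul w hw _ hu).mul_left _) ?_ hmain
  rw [tsum_mul_left, hγsum.tsum_eq]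
  have : 2 * C * (1 / (8 * C)) ≤ 1 / 2 := by
    have : 2 * C * (1 / (8 * C)) = 1 / 4 := by field_simp; norm_num
    linarith
  refine le_trans ?_ this
  gcongr

theorem wmul_single {n : ℕ} (w : ℤ →ᵇ ℝ) (j : ℕ) (v : ES n) :
    wmul w (lp.single 2 j v) = lp.single 2 j (((w j : ℝ) : ℂ) • v) := by
  ext i : 2
  rw [wmul_apply]
  obtain rfl | h := eq_or_ne i j
  · simp
  · simp [h]

theorem l2_ext {n : ℕ} {F : Type*} [AddCommMonoid F] [Module ℂ F] [TopologicalSpace F] [T2Space F]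
    {f g : l2 n →L[ℂ] F}
    (h : ∀ j b, f (lp.single 2 j (eVec n b)) = g (lp.single 2 j (eVec n b))) : f = g := by
  refine lp.ext_continuousLinearMap ENNReal.ofNat_ne_top fun j => ?_
  refine ContinuousLinearMap.coe_injective ?_
  refine (EuclideanSpace.basisFun (Fin n) ℂ).toBasis.ext fun b => ?_
  simpa using h j b

theorem inner_single_left_l2 {n : ℕ} (i : ℕ) (v : ES n) (u : l2 n) :
    inner ℂ (lp.single 2 i v : l2 n) u = inner ℂ v (u i) :=
  lp.inner_single_left i v u

/-- The isometric embedding of `ℂⁿ` as the `i`-th coordinate of `ℓ²₊(ℂⁿ)`. -/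
def singleLI (n i : ℕ) : ES n →ₗᵢ[ℂ] l2 n :=
  (lp.lsingle (𝕜 := ℂ) (E := fun _ : ℕ => ES n) 2 i).toLinearIsometry
    (lp.isometry_single (E := fun _ : ℕ => ES n) (p := 2) i)

theorem singleLI_apply (n i : ℕ) (v : ES n) : singleLI n i v = lp.single 2 i v := rfl

theorem orthogonalFamily_single_succ (n : ℕ) :
    OrthogonalFamily ℂ (fun _ : ℕ => ES n) fun i => singleLI n (i + 1) := by
  intro i j hij v w
  change inner ℂ (lp.single 2 (i + 1) v : l2 n) (lp.single 2 (j + 1) w : l2 n) = 0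
  rw [inner_single_left_l2, lp.single_apply_ne _ _ _ (by omega), inner_zero_right]

/-- The forward shift, as an isometry. -/
def shiftLI (n : ℕ) : l2 n →ₗᵢ[ℂ] l2 n :=
  (orthogonalFamily_single_succ n).linearIsometry

/-- The forward shift. -/
def shift (n : ℕ) : l2 n →L[ℂ] l2 n :=
  (shiftLI n).toContinuousLinearMap

theorem shift_single {n : ℕ} (i : ℕ) (v : ES n) :
    shift n (lp.single 2 i v) = lp.single 2 (i + 1) v :=
  (orthogonalFamily_single_succ n).linearIsometry_apply_single v

theorem norm_shift_le (n : ℕ) : ‖shift n‖ ≤ 1 :=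
  (shiftLI n).norm_toContinuousLinearMap_le

theorem adjoint_shift_apply {n : ℕ} (u : l2 n) (i : ℕ) : ((shift n).adjoint u) i = u (i + 1) := by
  refine ext_inner_left ℂ fun v : ES n => ?_
  refine (inner_single_left_l2 i v _).symm.trans ?_
  rw [ContinuousLinearMap.adjoint_inner_right, shift_single, inner_single_left_l2]

theorem shift_apply_zero {n : ℕ} (u : l2 n) : (shift n u) 0 = 0 := by
  refine ext_inner_left ℂ fun v : ES n => ?_
  refine (inner_single_left_l2 0 v _).symm.trans ?_
  rw [← ContinuousLinearMap.adjoint_inner_left]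
  have : (shift n).adjoint (lp.single 2 0 v) = 0 := by
    ext i : 2
    rw [adjoint_shift_apply]
    simp
  rw [this, inner_zero_left, inner_zero_right]

theorem shift_apply_succ {n : ℕ} (u : l2 n) (i : ℕ) : (shift n u) (i + 1) = u i := by
  refine ext_inner_left ℂ fun v : ES n => ?_
  refine (inner_single_left_l2 (i + 1) v _).symm.trans ?_
  rw [← shift_single]
  exact ((shiftLI n).inner_map_map _ _).trans (inner_single_left_l2 i v u)

theorem adjoint_shift_shift {n : ℕ} (u : l2 n) : (shift n).adjoint (shift n u) = u := by
  ext i : 2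
  rw [adjoint_shift_apply, shift_apply_succ]

theorem single_add_shift {n : ℕ} (u : l2 n) :
    lp.single 2 0 (u 0) + shift n ((shift n).adjoint u) = u := by
  ext i : 2
  rw [lp.coeFn_add, Pi.add_apply]
  cases i with
  | zero => rw [shift_apply_zero, lp.single_apply_self, add_zero]
  | succ i =>
    rw [shift_apply_succ, adjoint_shift_apply, lp.single_apply_ne _ _ _ (by omega), zero_add]

theorem hasDegree_shift (n : ℕ) : HasDegree 1 (shift n) := by
  intro w u
  have : wmul w ∘L shift n = shift n ∘L wmul (shiftWeight 1 w) := l2_ext fun j b => by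
    simp [shift_single, wmul_single]
  exact DFunLike.congr_fun this u

theorem hasDegree_shift_pow (n k : ℕ) : HasDegree k (shift n ^ k) := by
  induction k with
  | zero => exact fun w u => by simp [shiftWeight_zero]
  | succ k ih =>
    rw [pow_succ, Nat.cast_succ]
    exact ih.comp (hasDegree_shift n)

theorem shift_pow_single {n : ℕ} (k i : ℕ) (v : ES n) :
    (shift n ^ k) (lp.single 2 i v) = lp.single 2 (i + k) v := by
  induction k with
  | zero => simp
  | succ k ih =>
    rw [pow_succ', mul_apply_eq_comp, ih, shift_single, add_assoc]

theorem norm_shift_pow_le (n k : ℕ) : ‖shift n ^ k‖ ≤ 1 := by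
  induction k with
  | zero => exact ContinuousLinearMap.norm_id_le
  | succ k ih =>
    rw [pow_succ]
    exact (norm_mul_le _ _).trans (mul_le_one₀ ih (norm_nonneg _) (norm_shift_le n))

/-- The action of a matrix on Euclidean spaces. -/
def matCLM {m p : ℕ} (M : Matrix (Fin m) (Fin p) ℂ) : ES p →L[ℂ] ES m :=
  ∑ a, ∑ b, M a b • (EuclideanSpace.proj b : ES p →L[ℂ] ℂ).smulRight (eVec m a)

theorem matCLM_eVec {m p : ℕ} (M : Matrix (Fin m) (Fin p) ℂ) (a : Fin m) (b : Fin p) :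
    matCLM M (eVec p b) a = M a b := by
  simp [matCLM, Pi.single_apply]

theorem summable_norm_matCLM {m p : ℕ} (G : ℕ → Matrix (Fin m) (Fin p) ℂ)
    (hG : ∀ (a : Fin m) (b : Fin p), Summable fun ν => ‖G ν a b‖) :
    Summable fun ν => ‖matCLM (G ν)‖ := by
  have hs : Summable fun ν => ∑ a, ∑ b, ‖G ν a b‖ *
      ‖(EuclideanSpace.proj b : ES p →L[ℂ] ℂ).smulRight (eVec m a)‖ :=
    summable_sum fun a _ => summable_sum fun b _ => (hG a b).mul_right _
  refine hs.of_nonneg_of_le (fun _ => norm_nonneg _) fun ν => ?_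
  refine (norm_sum_le _ _).trans (Finset.sum_le_sum fun a _ => ?_)
  refine (norm_sum_le _ _).trans (Finset.sum_le_sum fun b _ => ?_)
  exact (norm_smul (G ν a b) _).le

/-- Coordinatewise application of a linear map. -/
def constMap {n n' : ℕ} (g : ES n →L[ℂ] ES n') : l2 n →L[ℂ] l2 n' :=
  lp.mapCLM 2 (fun _ => g) (norm_nonneg g) fun _ => le_rfl

@[simp]
theorem constMap_apply {n n' : ℕ} (g : ES n →L[ℂ] ES n') (u : l2 n) (i : ℕ) :
    (constMap g u) i = g (u i) := rfl

theorem constMap_single {n n' : ℕ} (g : ES n →L[ℂ] ES n') (j : ℕ) (v : ES n) :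
    constMap g (lp.single 2 j v) = lp.single 2 j (g v) := by
  ext i : 2
  rw [constMap_apply]
  obtain rfl | h := eq_or_ne i j
  · simp
  · simp [h]

theorem hasDegree_constMap {n n' : ℕ} (g : ES n →L[ℂ] ES n') : HasDegree 0 (constMap g) := by
  intro w u
  ext i : 2
  rw [wmul_apply, constMap_apply, constMap_apply, wmul_apply, map_smul, shiftWeight_zero]

theorem isWienerOp_of_toeplitz {m p : ℕ} (G : ℕ → Matrix (Fin m) (Fin p) ℂ)
    (hG : ∀ (a : Fin m) (b : Fin p), Summable fun ν => ‖G ν a b‖) (T : l2 p →L[ℂ] l2 m)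
    (hT : ∀ (j : ℕ) (b : Fin p) (i : ℕ) (a : Fin m),
      (T (lp.single 2 j (eVec p b))) i a = if j ≤ i then G (i - j) a b else 0) : IsWienerOp T := by
  have hs : Summable fun ν => ‖(shift m ^ ν) ∘L constMap (matCLM (G ν))‖ := by
    refine (summable_norm_matCLM G hG).of_nonneg_of_le (fun _ => norm_nonneg _) fun ν => ?_
    refine (ContinuousLinearMap.opNorm_comp_le _ _).trans ?_
    refine (mul_le_of_le_one_left (norm_nonneg _) (norm_shift_pow_le m ν)).trans ?_
    exact lp.norm_mapCLM_le _ _ _ _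
  refine ⟨ℕ, _, fun ν => ν + 0, hs, ?_,
    fun ν => (hasDegree_shift_pow m ν).comp (hasDegree_constMap _)⟩
  have hX := hs.of_norm.hasSum
  suffices h : T = ∑' ν, (shift m ^ ν) ∘L constMap (matCLM (G ν)) by rwa [h]
  refine l2_ext fun j b => ?_
  ext i a
  have h1 := (ContinuousLinearMap.apply ℂ (l2 m) (lp.single 2 j (eVec p b))).hasSum hX
  have h2 := ((EuclideanSpace.proj a : ES m →L[ℂ] ℂ) ∘L
    lp.evalCLM ℂ (fun _ : ℕ => ES m) 2 i).hasSum h1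
  have h3 : ∀ ν, ((EuclideanSpace.proj a : ES m →L[ℂ] ℂ) ∘L lp.evalCLM ℂ (fun _ : ℕ => ES m) 2 i)
      (ContinuousLinearMap.apply ℂ (l2 m) (lp.single 2 j (eVec p b))
        ((shift m ^ ν) ∘L constMap (matCLM (G ν)))) = if i = j + ν then G ν a b else 0 := by
    intro ν
    change ((shift m ^ ν) (constMap (matCLM (G ν)) (lp.single 2 j (eVec p b)))) i a = _
    rw [constMap_single, shift_pow_single]
    split_ifs with h
    · rw [h, lp.single_apply_self, matCLM_eVec]
    · rw [lp.single_apply_ne _ _ _ h]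
      rfl
  have h4 : HasSum (fun ν => if i = j + ν then G ν a b else 0)
      (if j ≤ i then G (i - j) a b else 0) := by
    split_ifs with h
    · have h4 := hasSum_single (f := fun ν => if i = j + ν then G ν a b else 0) (i - j)
        fun ν hν => if_neg (by omega)
      rwa [if_pos (by omega)] at h4
    · exact hasSum_zero.congr_fun fun ν => if_neg (by omega)
  rw [hT]
  exact (h4.congr_fun h3).unique h2

/-- The sequence `1, F 0, F 1, …`, the coefficients of `1 + ∑ ν, z ^ (ν + 1) F ν`. -/
def consOne {R : Type*} [One R] (F : ℕ → R) : ℕ → R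
  | 0 => 1
  | n + 1 => F n

@[simp]
theorem consOne_zero {R : Type*} [One R] (F : ℕ → R) : consOne F 0 = 1 := rfl

@[simp]
theorem consOne_succ {R : Type*} [One R] (F : ℕ → R) (n : ℕ) : consOne F (n + 1) = F n := rfl

theorem sum_antidiagonal_mul_consOne {R : Type*} [Ring R] (K : ℕ → ℕ → R)
    (hK : ∀ i j, K i (j + 1) = K (i + 1) j + K i 0 * K 0 j) (n s : ℕ) :
    ∑ x ∈ Finset.HasAntidiagonal.antidiagonal n, K (x.1 + s) 0 * consOne (K 0) x.2 = K s n := by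
  induction n generalizing s with
  | zero => simp
  | succ n ih =>
    rw [Finset.Nat.sum_antidiagonal_succ, hK, ← ih (s + 1), add_comm]
    simp only [zero_add, consOne_succ, add_assoc, add_comm 1 s]

theorem sum_antidiagonal_consOne_mul_consOne {R : Type*} [Ring R] (K : ℕ → ℕ → R)
    (hK : ∀ i j, K i (j + 1) = K (i + 1) j + K i 0 * K 0 j) (n : ℕ) :
    ∑ x ∈ Finset.HasAntidiagonal.antidiagonal n, consOne (fun i => -K i 0) x.1 * consOne (K 0) x.2 =
      if n = 0 then 1 else 0 := by
  cases n with
  | zero => simp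
  | succ n =>
    have := sum_antidiagonal_mul_consOne K hK n 0
    rw [Finset.Nat.sum_antidiagonal_succ, if_neg n.succ_ne_zero]
    simp only [add_zero] at this
    simp [this]

theorem summable_norm_pow_mul {f : ℕ → ℂ} (hf : Summable fun ν => ‖f ν‖) {z : ℂ} (hz : ‖z‖ ≤ 1) :
    Summable fun ν => ‖z ^ ν * f ν‖ := by
  refine hf.of_nonneg_of_le (fun _ => norm_nonneg _) fun ν => ?_
  rw [norm_mul, norm_pow]
  exact mul_le_of_le_one_left (norm_nonneg _) (pow_le_one₀ (norm_nonneg z) hz)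

theorem seriesM_mul {r s t : ℕ} {F : ℕ → Matrix (Fin r) (Fin s) ℂ}
    {H : ℕ → Matrix (Fin s) (Fin t) ℂ}
    (hF : ∀ a b, Summable fun ν => ‖F ν a b‖) (hH : ∀ a b, Summable fun ν => ‖H ν a b‖)
    {z : ℂ} (hz : ‖z‖ ≤ 1) :
    seriesM F z * seriesM H z =
      seriesM (fun n => ∑ x ∈ Finset.HasAntidiagonal.antidiagonal n, F x.1 * H x.2) z := by
  ext a b
  have hsum : ∀ c, Summable fun n => ∑ x ∈ Finset.HasAntidiagonal.antidiagonal n,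
      (z ^ x.1 * F x.1 a c) * (z ^ x.2 * H x.2 c b) := fun c =>
    (summable_norm_sum_mul_antidiagonal_of_summable_norm (summable_norm_pow_mul (hF a c) hz)
      (summable_norm_pow_mul (hH c b) hz)).of_norm
  simp only [Matrix.mul_apply, seriesM, Matrix.of_apply]
  simp_rw [fun c => tsum_mul_tsum_eq_tsum_sum_antidiagonal_of_summable_norm
    (summable_norm_pow_mul (hF a c) hz) (summable_norm_pow_mul (hH c b) hz)]
  rw [← Summable.tsum_finsetSum fun c _ => hsum c]
  refine tsum_congr fun n => ?_
  rw [Finset.sum_comm, Matrix.sum_apply, Finset.mul_sum]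
  refine Finset.sum_congr rfl fun x hx => ?_
  rw [Matrix.mul_apply, Finset.mul_sum, ← Finset.HasAntidiagonal.mem_antidiagonal.mp hx, pow_add]
  exact Finset.sum_congr rfl fun c _ => by ring

theorem summable_norm_consOne {n : ℕ} {F : ℕ → Matrix (Fin n) (Fin n) ℂ} {a b : Fin n}
    (hF : Summable fun ν => ‖F ν a b‖) : Summable fun ν => ‖consOne F ν a b‖ :=
  (summable_nat_add_iff 1).mp hF

theorem seriesM_consOne_apply {n : ℕ} {F : ℕ → Matrix (Fin n) (Fin n) ℂ} {a b : Fin n}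
    (hF : Summable fun ν => ‖F ν a b‖) {z : ℂ} (hz : ‖z‖ ≤ 1) :
    seriesM (consOne F) z a b = (if a = b then 1 else 0) + z * ∑' ν, z ^ ν * F ν a b := by
  rw [seriesM, Matrix.of_apply,
    (summable_norm_pow_mul (summable_norm_consOne hF) hz).of_norm.tsum_eq_zero_add, ← tsum_mul_left]
  simp only [consOne_zero, consOne_succ, pow_zero, one_mul, Matrix.one_apply, pow_succ', mul_assoc]

theorem seriesM_consOne_mul_consOne {n : ℕ} (K : ℕ → ℕ → Matrix (Fin n) (Fin n) ℂ)
    (hK : ∀ i j, K i (j + 1) = K (i + 1) j + K i 0 * K 0 j)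
    (hcol : ∀ a b, Summable fun i => ‖K i 0 a b‖) (hrow : ∀ a b, Summable fun j => ‖K 0 j a b‖)
    {z : ℂ} (hz : ‖z‖ ≤ 1) :
    seriesM (consOne fun i => -K i 0) z * seriesM (consOne (K 0)) z = 1 := by
  rw [seriesM_mul (fun a b => summable_norm_consOne (by simpa using hcol a b))
    (fun a b => summable_norm_consOne (hrow a b)) hz]
  simp_rw [sum_antidiagonal_consOne_mul_consOne K hK]
  ext a b
  rw [seriesM, Matrix.of_apply, tsum_eq_single 0 fun ν hν => by simp [hν]]
  simp

theorem summable_norm_l2_of_coord {n : ℕ} {u : l2 n} (hu : ∀ a, Summable fun i => ‖u i a‖) :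
    Summable fun i => ‖u i‖ := by
  refine (summable_sum (s := Finset.univ) fun a _ => hu a).of_nonneg_of_le
    (fun _ => norm_nonneg _) fun i => ?_
  conv_lhs => rw [← (EuclideanSpace.basisFun (Fin n) ℂ).sum_repr (u i)]
  refine (norm_sum_le _ _).trans (Finset.sum_le_sum fun a _ => ?_)
  simp [norm_smul]

theorem single_eq_sum {n : ℕ} (i : ℕ) (v : ES n) :
    (lp.single 2 i v : l2 n) = ∑ c, v c • lp.single 2 i (eVec n c) := by
  have h := congrArg (singleLI n i) ((EuclideanSpace.basisFun (Fin n) ℂ).sum_repr v)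
  rw [map_sum] at h
  refine h.symm.trans (Finset.sum_congr rfl fun c _ => ?_)
  rw [map_smul]
  simp [singleLI_apply]

theorem summable_swap_of_nonneg {f : ℕ → ℕ → ℝ} (hf : ∀ i j, 0 ≤ f i j)
    (hs : ∀ i, Summable fun j => f i j) (ht : Summable fun i => ∑' j, f i j) :
    (∀ j, Summable fun i => f i j) ∧ Summable fun j => ∑' i, f i j := by
  have h : Summable fun x : ℕ × ℕ => f x.1 x.2 :=
    (summable_prod_of_nonneg fun x => hf x.1 x.2).mpr ⟨hs, ht⟩
  exact (summable_prod_of_nonneg fun x => hf x.2 x.1).mp h.prod_symm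

section BlockOperators

variable {m p : ℕ} {G : ℕ → Matrix (Fin m) (Fin p) ℂ} {TG HG : l2 p →L[ℂ] l2 m}

theorem toeplitz_comp_shift
    (hTG : ∀ (j : ℕ) (b : Fin p) (i : ℕ) (a : Fin m),
      (TG (lp.single 2 j (eVec p b))) i a = if j ≤ i then G (i - j) a b else 0) :
    TG ∘L shift p = shift m ∘L TG := by
  refine l2_ext fun j b => ?_
  ext i a
  rw [ContinuousLinearMap.comp_apply, ContinuousLinearMap.comp_apply, shift_single, hTG]
  cases i with
  | zero => simp [shift_apply_zero]
  | succ i => simp [shift_apply_succ, hTG]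

theorem adjoint_shift_adjoint_toeplitz
    (hTG : ∀ (j : ℕ) (b : Fin p) (i : ℕ) (a : Fin m),
      (TG (lp.single 2 j (eVec p b))) i a = if j ≤ i then G (i - j) a b else 0) (y : l2 m) :
    (shift p).adjoint (TG.adjoint y) = TG.adjoint ((shift m).adjoint y) := by
  have h := congrArg ContinuousLinearMap.adjoint (toeplitz_comp_shift hTG)
  rw [ContinuousLinearMap.adjoint_comp, ContinuousLinearMap.adjoint_comp] at h
  exact DFunLike.congr_fun h y

theorem adjoint_shift_hankel
    (hHG : ∀ (j : ℕ) (b : Fin p) (i : ℕ) (a : Fin m),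
      (HG (lp.single 2 j (eVec p b))) i a = G (i + j + 1) a b) (j : ℕ) (b : Fin p) :
    (shift m).adjoint (HG (lp.single 2 j (eVec p b))) = HG (lp.single 2 (j + 1) (eVec p b)) := by
  ext i a
  rw [adjoint_shift_apply, hHG, hHG]
  congr 2
  omega

theorem adjoint_shift_toeplitz_single_zero
    (hTG : ∀ (j : ℕ) (b : Fin p) (i : ℕ) (a : Fin m),
      (TG (lp.single 2 j (eVec p b))) i a = if j ≤ i then G (i - j) a b else 0)
    (hHG : ∀ (j : ℕ) (b : Fin p) (i : ℕ) (a : Fin m),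
      (HG (lp.single 2 j (eVec p b))) i a = G (i + j + 1) a b) (b : Fin p) :
    (shift m).adjoint (TG (lp.single 2 0 (eVec p b))) = HG (lp.single 2 0 (eVec p b)) := by
  ext i a
  rw [adjoint_shift_apply, hHG, hTG, if_pos (Nat.zero_le _)]
  simp

/-- The displacement identity of the operator `T_G* (T_G T_G*)⁻¹ H_G`. -/
theorem corona_displacement
    (hTG : ∀ (j : ℕ) (b : Fin p) (i : ℕ) (a : Fin m),
      (TG (lp.single 2 j (eVec p b))) i a = if j ≤ i then G (i - j) a b else 0)
    (hHG : ∀ (j : ℕ) (b : Fin p) (i : ℕ) (a : Fin m),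
      (HG (lp.single 2 j (eVec p b))) i a = G (i + j + 1) a b)
    {Tinv : l2 m →L[ℂ] l2 m} (hT1 : ∀ x, Tinv (TG (TG.adjoint x)) = x)
    (hT2 : ∀ x, TG (TG.adjoint (Tinv x)) = x) (j : ℕ) (b : Fin p) :
    TG.adjoint (Tinv (HG (lp.single 2 (j + 1) (eVec p b)))) =
      (shift p).adjoint (TG.adjoint (Tinv (HG (lp.single 2 j (eVec p b))))) +
      ∑ c, (TG.adjoint (Tinv (HG (lp.single 2 j (eVec p b))))) 0 c •
        TG.adjoint (Tinv (HG (lp.single 2 0 (eVec p c)))) := by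
  set k := TG.adjoint (Tinv (HG (lp.single 2 j (eVec p b)))) with hk
  have hTk : TG k = HG (lp.single 2 j (eVec p b)) := hT2 _
  have hcomm : ∀ u, TG (shift p u) = shift m (TG u) := fun u =>
    DFunLike.congr_fun (toeplitz_comp_shift hTG) u
  have h1 : HG (lp.single 2 (j + 1) (eVec p b)) =
      TG ((shift p).adjoint k) + ∑ c, k 0 c • HG (lp.single 2 0 (eVec p c)) := by
    rw [← adjoint_shift_hankel hHG, ← hTk]
    conv_lhs => rw [← single_add_shift k]
    rw [map_add, map_add, hcomm, adjoint_shift_shift, single_eq_sum, map_sum, map_sum, add_comm]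
    simp only [map_smul, adjoint_shift_toeplitz_single_zero hTG hHG]
  rw [h1, hk, adjoint_shift_adjoint_toeplitz hTG, ← hk]
  simp only [map_add, map_sum, map_smul, hT1]

theorem summable_norm_adjoint_toeplitz_inv (hGW : ∀ a b, Summable fun ν => ‖G ν a b‖)
    (hTG : ∀ (j : ℕ) (b : Fin p) (i : ℕ) (a : Fin m),
      (TG (lp.single 2 j (eVec p b))) i a = if j ≤ i then G (i - j) a b else 0)
    {Tinv : l2 m →L[ℂ] l2 m} (hT1 : ∀ x, Tinv (TG (TG.adjoint x)) = x)
    (hT2 : ∀ x, TG (TG.adjoint (Tinv x)) = x) (u : l2 m) (hu : Summable fun i => ‖u i‖) :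
    Summable fun i => ‖(Tinv u) i‖ := by
  have hW := isWienerOp_of_toeplitz G hGW TG hTG
  refine (hW.comp hW.adjoint).summable_of_apply (C := ‖Tinv‖) (fun v => ?_) _ ?_
  · have := Tinv.le_opNorm (TG (TG.adjoint v))
    rwa [hT1] at this
  · simpa only [ContinuousLinearMap.comp_apply, hT2] using hu

theorem summable_norm_coord {n : ℕ} {u : l2 n} (hu : Summable fun i => ‖u i‖) (a : Fin n) :
    Summable fun i => ‖u i a‖ :=
  hu.of_nonneg_of_le (fun _ => norm_nonneg _) fun i => PiLp.norm_apply_le (u i) a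

theorem summable_norm_hankel_pairing (hGW : ∀ a b, Summable fun ν => ‖G ν a b‖)
    (hHG : ∀ (j : ℕ) (b : Fin p) (i : ℕ) (a : Fin m),
      (HG (lp.single 2 j (eVec p b))) i a = G (i + j + 1) a b) (y : l2 m)
    (hy : Summable fun i => ‖y i‖) (b : Fin p) :
    Summable fun j => ‖inner ℂ y (HG (lp.single 2 j (eVec p b)))‖ := by
  have hS : ∀ a i, Summable fun j => ‖G (i + j + 1) a b‖ := fun a i => by
    refine ((summable_nat_add_iff (i + 1)).mpr (hGW a b)).congr fun j => ?_
    rw [add_left_comm, ← add_assoc]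
  have hle : ∀ a i, ∑' j, ‖G (i + j + 1) a b‖ ≤ ∑' ν, ‖G ν a b‖ := fun a i =>
    (hS a i).tsum_le_tsum_of_inj (fun j => i + j + 1) (fun _ _ h => by simpa using h)
      (fun _ _ => norm_nonneg _) (fun _ => le_rfl) (hGW a b)
  have hsum : ∀ i, Summable fun j => ∑ a, ‖y i a‖ * ‖G (i + j + 1) a b‖ := fun i =>
    summable_sum fun a _ => (hS a i).mul_left _
  have htsum : Summable fun i => ∑' j, ∑ a, ‖y i a‖ * ‖G (i + j + 1) a b‖ := by
    have h : Summable fun i => ∑ a, ‖y i a‖ * ∑' ν, ‖G ν a b‖ :=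
      summable_sum fun a _ => (summable_norm_coord hy a).mul_right _
    refine h.of_nonneg_of_le (fun i => tsum_nonneg fun j => ?_) fun i => ?_
    · positivity
    · rw [Summable.tsum_finsetSum fun a _ => (hS a i).mul_left _]
      refine Finset.sum_le_sum fun a _ => ?_
      rw [tsum_mul_left]
      exact mul_le_mul_of_nonneg_left (hle a i) (norm_nonneg _)
  obtain ⟨h1, h2⟩ := summable_swap_of_nonneg (fun i j => by positivity) hsum htsum
  refine h2.of_nonneg_of_le (fun _ => norm_nonneg _) fun j => ?_
  rw [lp.inner_eq_tsum]
  refine tsum_of_norm_bounded (h1 j).hasSum fun i => ?_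
  rw [PiLp.inner_apply]
  refine (norm_sum_le _ _).trans (Finset.sum_le_sum fun a _ => ?_)
  rw [hHG, RCLike.inner_apply, norm_mul, RCLike.norm_conj, mul_comm]

theorem summable_norm_toeplitz_single (hGW : ∀ a b, Summable fun ν => ‖G ν a b‖)
    (hTG : ∀ (j : ℕ) (b : Fin p) (i : ℕ) (a : Fin m),
      (TG (lp.single 2 j (eVec p b))) i a = if j ≤ i then G (i - j) a b else 0) (b : Fin p) :
    Summable fun i => ‖(TG (lp.single 2 0 (eVec p b))) i‖ :=
  summable_norm_l2_of_coord fun a => by simpa [hTG] using hGW a b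

theorem summable_norm_hankel_single (hGW : ∀ a b, Summable fun ν => ‖G ν a b‖)
    (hHG : ∀ (j : ℕ) (b : Fin p) (i : ℕ) (a : Fin m),
      (HG (lp.single 2 j (eVec p b))) i a = G (i + j + 1) a b) (b : Fin p) :
    Summable fun i => ‖(HG (lp.single 2 0 (eVec p b))) i‖ :=
  summable_norm_l2_of_coord fun a => by
    simpa [hHG] using (summable_nat_add_iff 1).mpr (hGW a b)

theorem summable_norm_corona_col (hGW : ∀ a b, Summable fun ν => ‖G ν a b‖)
    (hTG : ∀ (j : ℕ) (b : Fin p) (i : ℕ) (a : Fin m),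
      (TG (lp.single 2 j (eVec p b))) i a = if j ≤ i then G (i - j) a b else 0)
    (hHG : ∀ (j : ℕ) (b : Fin p) (i : ℕ) (a : Fin m),
      (HG (lp.single 2 j (eVec p b))) i a = G (i + j + 1) a b)
    {Tinv : l2 m →L[ℂ] l2 m} (hT1 : ∀ x, Tinv (TG (TG.adjoint x)) = x)
    (hT2 : ∀ x, TG (TG.adjoint (Tinv x)) = x) (a b : Fin p) :
    Summable fun i => ‖(TG.adjoint (Tinv (HG (lp.single 2 0 (eVec p b))))) i a‖ :=
  summable_norm_coord ((isWienerOp_of_toeplitz G hGW TG hTG).adjoint.summable_apply _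
    (summable_norm_adjoint_toeplitz_inv hGW hTG hT1 hT2 _
      (summable_norm_hankel_single hGW hHG b))) a

theorem summable_norm_corona_row (hGW : ∀ a b, Summable fun ν => ‖G ν a b‖)
    (hTG : ∀ (j : ℕ) (b : Fin p) (i : ℕ) (a : Fin m),
      (TG (lp.single 2 j (eVec p b))) i a = if j ≤ i then G (i - j) a b else 0)
    (hHG : ∀ (j : ℕ) (b : Fin p) (i : ℕ) (a : Fin m),
      (HG (lp.single 2 j (eVec p b))) i a = G (i + j + 1) a b)
    {Tinv : l2 m →L[ℂ] l2 m} (hT1 : ∀ x, Tinv (TG (TG.adjoint x)) = x)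
    (hT2 : ∀ x, TG (TG.adjoint (Tinv x)) = x) (a b : Fin p) :
    Summable fun j => ‖(TG.adjoint (Tinv (HG (lp.single 2 j (eVec p b))))) 0 a‖ := by
  refine (summable_norm_hankel_pairing hGW hHG (Tinv (TG (lp.single 2 0 (eVec p a))))
    (summable_norm_adjoint_toeplitz_inv hGW hTG hT1 hT2 _
      (summable_norm_toeplitz_single hGW hTG a)) b).congr fun j => congrArg _ ?_
  set x := TG (lp.single 2 0 (eVec p a))
  set h := HG (lp.single 2 j (eVec p b))
  have h1 : inner ℂ (Tinv x) h = inner ℂ x (Tinv h) := by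
    conv_lhs => rw [← hT2 h]
    conv_rhs => rw [← hT2 x]
    rw [← ContinuousLinearMap.adjoint_inner_left, ContinuousLinearMap.adjoint_inner_right]
  rw [h1, ← ContinuousLinearMap.adjoint_inner_right, inner_single_left_l2,
    EuclideanSpace.inner_single_left]
  simp

theorem corona_tsum_apply
    (R : l2 p →L[ℂ] l2 p) {z : ℂ} (hz : ‖z‖ < 1) (a b : Fin p) :
    (R (∑' i : ℕ, z ^ i • lp.single 2 i (eVec p b))) 0 a =
      ∑' i : ℕ, z ^ i * (R (lp.single 2 i (eVec p b))) 0 a := by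
  have hs : Summable fun i : ℕ => z ^ i • (lp.single 2 i (eVec p b) : l2 p) := by
    refine .of_norm ((summable_geometric_of_lt_one (norm_nonneg z) hz).congr fun i => ?_)
    rw [norm_smul, norm_pow, lp.norm_single (by norm_num)]
    simp
  have h := (((EuclideanSpace.proj a : ES p →L[ℂ] ℂ) ∘L
    lp.evalCLM ℂ (fun _ : ℕ => ES p) 2 0) ∘L R).map_tsum hs
  refine h.trans (tsum_congr fun i => ?_)
  rw [map_smul]
  rfl

end BlockOperators

/-- If `G ∈ W₊^{m×p}` and `T_G T_G*` is strictly positive, then the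
function `Y` belongs to `W₊^{p×p}` (its Taylor coefficients are absolutely summable),
`det Y(z) ≠ 0` on the closed unit disc, `Y⁻¹` belongs to `W₊^{p×p}` (so `Y` is
invertible outer), and `Y(z)⁻¹ = I_p + z E_p* T_G*(T_G T_G*)⁻¹ H_G (I − z S_p)⁻¹ E_p`
for `z ∈ 𝔻`. -/
theorem bezout_corona_stmt11
    (m p : ℕ) (hm : 0 < m) (hmp : m ≤ p)
    (G : ℕ → Matrix (Fin m) (Fin p) ℂ)
    (hGW : ∀ (a : Fin m) (b : Fin p), Summable fun ν => ‖G ν a b‖)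
    (TG : l2 p →L[ℂ] l2 m)
    (hTG : ∀ (j : ℕ) (b : Fin p) (i : ℕ) (a : Fin m),
      (TG (lp.single 2 j (eVec p b))) i a = if j ≤ i then G (i - j) a b else 0)
    (HG : l2 p →L[ℂ] l2 m)
    (hHG : ∀ (j : ℕ) (b : Fin p) (i : ℕ) (a : Fin m),
      (HG (lp.single 2 j (eVec p b))) i a = G (i + j + 1) a b)
    (Tinv : l2 m →L[ℂ] l2 m)
    (hT1 : ∀ x, Tinv (TG (TG.adjoint x)) = x)
    (hT2 : ∀ x, TG (TG.adjoint (Tinv x)) = x)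
    (Y : ℂ → Matrix (Fin p) (Fin p) ℂ)
    (hY : ∀ z ∈ Metric.ball (0 : ℂ) 1, ∀ (a b : Fin p),
      Y z a b = (if a = b then 1 else 0)
        - z * ∑' i : ℕ, z ^ i *
            (TG.adjoint (Tinv (HG (lp.single 2 0 (eVec p b))))) i a) :
    ∃ Yc : ℕ → Matrix (Fin p) (Fin p) ℂ,
      (∀ a b, Summable fun ν => ‖Yc ν a b‖) ∧
      (∀ z ∈ Metric.ball (0 : ℂ) 1, Y z = seriesM Yc z) ∧
      (∀ z : ℂ, ‖z‖ ≤ 1 → (seriesM Yc z).det ≠ 0) ∧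
      (∃ Wc : ℕ → Matrix (Fin p) (Fin p) ℂ,
        (∀ a b, Summable fun ν => ‖Wc ν a b‖) ∧
        ∀ z : ℂ, ‖z‖ ≤ 1 →
          seriesM Yc z * seriesM Wc z = 1 ∧ seriesM Wc z * seriesM Yc z = 1) ∧
      (∀ z ∈ Metric.ball (0 : ℂ) 1, ∀ a b : Fin p,
        (Y z)⁻¹ a b = (if a = b then 1 else 0)
          + z * (TG.adjoint (Tinv (HG (∑' i : ℕ, z ^ i • lp.single 2 i (eVec p b))))) 0 a) := by
  let K : ℕ → ℕ → Matrix (Fin p) (Fin p) ℂ := fun i j =>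
    Matrix.of fun a b => (TG.adjoint (Tinv (HG (lp.single 2 j (eVec p b))))) i a
  have hK : ∀ i j, K i (j + 1) = K (i + 1) j + K i 0 * K 0 j := by
    intro i j
    ext a b
    have h := congrArg (fun u : l2 p => ((EuclideanSpace.proj a : ES p →L[ℂ] ℂ) ∘L
      lp.evalCLM ℂ (fun _ : ℕ => ES p) 2 i) u) (corona_displacement hTG hHG hT1 hT2 j b)
    simp only [map_add, map_sum, map_smul] at h
    refine h.trans (congrArg₂ (· + ·) ?_ ?_)
    · exact congrArg (fun v : ES p => v a) (adjoint_shift_apply _ i)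
    · exact Finset.sum_congr rfl fun c _ => mul_comm _ _
  have hcol : ∀ a b, Summable fun i => ‖K i 0 a b‖ :=
    summable_norm_corona_col hGW hTG hHG hT1 hT2
  have hcol' : ∀ a b, Summable fun i => ‖(-K i 0) a b‖ := fun a b => by
    simpa using hcol a b
  have hrow : ∀ a b, Summable fun j => ‖K 0 j a b‖ :=
    summable_norm_corona_row hGW hTG hHG hT1 hT2
  have hmul : ∀ z : ℂ, ‖z‖ ≤ 1 →
      seriesM (consOne fun i => -K i 0) z * seriesM (consOne (K 0)) z = 1 := fun z hz =>
    seriesM_consOne_mul_consOne K hK hcol hrow hz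
  have hYeq : ∀ z ∈ Metric.ball (0 : ℂ) 1, Y z = seriesM (consOne fun i => -K i 0) z := by
    intro z hz
    ext a b
    rw [hY z hz, seriesM_consOne_apply (hcol' a b) (mem_ball_zero_iff.mp hz).le]
    simp only [Matrix.neg_apply, mul_neg, tsum_neg, ← sub_eq_add_neg]
    rfl
  refine ⟨_, fun a b => summable_norm_consOne (hcol' a b), hYeq, fun z hz => ?_,
    ⟨_, fun a b => summable_norm_consOne (hrow a b), fun z hz =>
      ⟨hmul z hz, mul_eq_one_comm.mp (hmul z hz)⟩⟩, fun z hz a b => ?_⟩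
  · exact (Matrix.isUnit_det_of_right_inverse (hmul z hz)).ne_zero
  · have hz' : ‖z‖ < 1 := mem_ball_zero_iff.mp hz
    rw [hYeq z hz, Matrix.inv_eq_right_inv (hmul z hz'.le),
      seriesM_consOne_apply (hrow a b) hz'.le]
    exact congrArg _ (congrArg _
      (corona_tsum_apply (TG.adjoint ∘L Tinv ∘L HG) hz' a b).symm)
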